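/- arXiv:2010.10617 — 2 statements merged into one kernel-verified Lean document; each statement's English description precedes it below -/
import Mathlib

section
/- Fix t₁ ∈ ℂ. Let u : ℕ → ℂ[X] be a sequence of nonzero polynomials with u₀ = 1, u₁ = X, satisfying the generalized Yablonskii–Vorobiev recurrence u_{m+1}·u_{m−1} = X·u_m² − 4(u_m·u_m⁗ − 4·u_m′·u_m‴ + 3·(u_m″)²) − 4t₁·(u_m·u_m″ − (u_m′)²) for all m ≥ 1. For k ≥ 0 define h_k := Σ_{(i,j,l) ∈ ℕ³: i+3j+5l=k} (1/(i!·j!·l!))·(−4t₁/3)^j·(−16/5)^l·X^i ∈ ℂ[X], h_k := 0 for k < 0, and let τ_m be the determinant of the m × m matrix with (i,j) entry h_{m+j−2i+1} (with τ₀ := 1). Then for every m ≥ 0, τ_m = c_m·u_m where c_m := ∏_{k=1}^{m} (2k+1)^{k−m} ∈ ℚ; in particular the proportionality constant c_m does not depend on t₁. -/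
open Polynomial

/-- The complete homogeneous polynomials `h_k` for the second member of the
non-stationary second Painlevé hierarchy, defined by
`Σ_k h_k λ^k = exp(Xλ − (4/3)t₁λ³ − (16/5)λ⁵)`; `h_k = 0` for `k < 0`. -/
noncomputable def painleveH2 (t₁ : ℂ) (k : ℤ) : Polynomial ℂ :=
  if k < 0 then 0
  else
    ∑ p ∈ ((Finset.range (k.toNat + 1) ×ˢ Finset.range (k.toNat + 1)) ×ˢ
          Finset.range (k.toNat + 1)).filter
        (fun p => p.1.1 + 3 * p.1.2 + 5 * p.2 = k.toNat),
      Polynomial.C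
          ((1 / ((Nat.factorial p.1.1 : ℂ) * (Nat.factorial p.1.2 : ℂ) *
              (Nat.factorial p.2 : ℂ))) *
            ((-4 : ℂ) * t₁ / 3) ^ p.1.2 * ((-16 : ℂ) / 5) ^ p.2) *
        X ^ p.1.1

/-- The Jacobi–Trudi polynomial τ-function: the `m × m` determinant with
(1-based) `(i,j)` entry `h_{m+j−2i+1}`. -/
noncomputable def painleveTau2 (t₁ : ℂ) (m : ℕ) : Polynomial ℂ :=
  Matrix.det (Matrix.of fun i j : Fin m =>
    painleveH2 t₁ ((m : ℤ) + ((j : ℕ) : ℤ) - 2 * ((i : ℕ) : ℤ)))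

open scoped Differential

theorem degreeLT_X_mul {F : Type*} [Field F] {n : ℕ} {p : F[X]}
    (hp : p ∈ degreeLT F n) : X * p ∈ degreeLT F (n + 1) := by
  rw [mem_degreeLT, degree_lt_iff_coeff_zero] at *
  intro k hk
  obtain ⟨k, rfl⟩ : ∃ j, k = j + 1 := ⟨k - 1, by omega⟩
  rw [coeff_X_mul]
  exact hp k (by omega)

theorem degreeLT_C_mul {F : Type*} [Field F] {n : ℕ} {p : F[X]} (c : F) (hp : p ∈ degreeLT F n) :
    C c * p ∈ degreeLT F n := by
  rw [← smul_eq_C_mul]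
  exact Submodule.smul_mem _ _ hp

theorem mem_degreeLT_of_monic {F : Type*} [Field F] {n : ℕ} {p : F[X]} (hp : p.Monic)
    (hn : p.natDegree = n) :
    p ∈ degreeLT F (n + 1) := by
  rw [mem_degreeLT, degree_eq_natDegree hp.ne_zero, hn]
  exact_mod_cast n.lt_succ_self

theorem sub_coeff_mul_mem_degreeLT {F : Type*} [Field F] {n : ℕ} {p q : F[X]}
    (hp : p ∈ degreeLT F (n + 1)) (hq : q.Monic) (hn : q.natDegree = n) :
    p - C (p.coeff n) * q ∈ degreeLT F n := by
  have h := Submodule.sub_mem _ hp (degreeLT_C_mul (p.coeff n) (mem_degreeLT_of_monic hq hn))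
  rw [mem_degreeLT, degree_lt_iff_coeff_zero] at *
  intro k hk
  rcases hk.eq_or_lt with rfl | hk
  · have := hq.coeff_natDegree
    rw [hn] at this
    simp [this]
  · exact h k hk

theorem divX_mem_degreeLT {F : Type*} [Field F] {n : ℕ} {p : F[X]} (hp : p ∈ degreeLT F (n + 1)) :
    p.divX ∈ degreeLT F n := by
  rw [mem_degreeLT, degree_lt_iff_coeff_zero] at *
  intro k hk
  rw [coeff_divX]
  exact hp _ (by omega)

section DifferentialOperators

variable {F : Type*} [Field F] [Differential F]

/-- The differential operator `∑ pᵢ ∂ⁱ` with coefficients those of `p`, applied to `f`. -/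
noncomputable def diffOp (f : F) : F[X] →ₗ[F] F :=
  Polynomial.lsum fun i => LinearMap.toSpanSingleton F F (Differential.deriv^[i] f)

theorem diffOp_monomial (f : F) (n : ℕ) (c : F) :
    diffOp f (monomial n c) = c * Differential.deriv^[n] f := by
  simp [diffOp, Polynomial.lsum, Polynomial.sum_monomial_index]

theorem diffOp_C_mul (f c : F) (p : F[X]) : diffOp f (C c * p) = c * diffOp f p := by
  rw [← smul_eq_C_mul, map_smul, smul_eq_mul]

theorem diffOp_X_mul (f : F) (p : F[X]) : diffOp f (X * p) = diffOp f′ p := by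
  induction p using Polynomial.induction_on' with
  | add p q hp hq => simp only [mul_add, map_add, hp, hq]
  | monomial n c =>
    rw [X_mul_monomial, diffOp_monomial, diffOp_monomial, Function.iterate_succ_apply]

theorem diffOp_mapCoeffs (f : F) (p : F[X]) :
    diffOp f (Differential.mapCoeffs p) = (diffOp f p)′ - diffOp f′ p := by
  induction p using Polynomial.induction_on' with
  | add p q hp hq => simp only [map_add, hp, hq]; ring
  | monomial n c =>
    simp only [Differential.mapCoeffs_monomial, diffOp_monomial, Derivation.leibniz, smul_eq_mul,
      ← Function.iterate_succ_apply, Function.iterate_succ_apply']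
    ring

theorem diffOp_zero_apply (p : F[X]) : diffOp (0 : F) p = 0 := by
  have h (n : ℕ) : Differential.deriv^[n] (0 : F) = 0 := by
    induction n with
    | zero => rfl
    | succ n ih => rw [Function.iterate_succ_apply, map_zero, ih]
  induction p using Polynomial.induction_on' with
  | add p q hp hq => rw [map_add, hp, hq, add_zero]
  | monomial n c => rw [diffOp_monomial, h, mul_zero]

theorem diffOp_add_apply (f g : F) (p : F[X]) : diffOp (f + g) p = diffOp f p + diffOp g p := by
  have h (n : ℕ) : Differential.deriv^[n] (f + g) =
      Differential.deriv^[n] f + Differential.deriv^[n] g := by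
    induction n with
    | zero => rfl
    | succ n ih => simp only [Function.iterate_succ_apply', map_add, ih]
  induction p using Polynomial.induction_on' with
  | add p q hp hq => simp only [map_add, hp, hq]; ring
  | monomial n c => simp only [diffOp_monomial, h]; ring

theorem diffOp_const_mul_apply {c : F} (hc : c′ = 0) (f : F) (p : F[X]) :
    diffOp (c * f) p = c * diffOp f p := by
  have h (n : ℕ) : Differential.deriv^[n] (c * f) = c * Differential.deriv^[n] f := by
    induction n with
    | zero => rfl
    | succ n ih => simp [Function.iterate_succ_apply', ih, hc]
  induction p using Polynomial.induction_on' with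
  | add p q hp hq => simp only [map_add, hp, hq]; ring
  | monomial n c => simp only [diffOp_monomial, h]; ring

theorem diffOp_coordinate_mul_apply {x : F} (hx : x′ = 1) (f : F) (p : F[X]) :
    diffOp (x * f) p = x * diffOp f p + diffOp f (derivative p) := by
  have h (n : ℕ) : Differential.deriv^[n] (x * f) =
      x * Differential.deriv^[n] f + n * Differential.deriv^[n - 1] f := by
    induction n with
    | zero => simp
    | succ n ih =>
      rw [Function.iterate_succ_apply', ih]
      rcases n with _ | n
      · simp [hx]
      · simp [Function.iterate_succ_apply', hx]
        ring
  induction p using Polynomial.induction_on' with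
  | add p q hp hq => simp only [map_add, hp, hq]; ring
  | monomial n c => simp only [diffOp_monomial, derivative_monomial, h]; ring

theorem degreeLT_mapCoeffs {n : ℕ} {p : F[X]} (hp : p ∈ degreeLT F n) :
    Differential.mapCoeffs p ∈ degreeLT F n := by
  rw [mem_degreeLT, degree_lt_iff_coeff_zero] at *
  intro k hk
  rw [Differential.coeff_mapCoeffs, hp k hk, map_zero]

theorem mapCoeffs_mem_degreeLT_of_monic {n : ℕ} {p : F[X]} (hp : p.Monic)
    (hn : p.natDegree = n) : Differential.mapCoeffs p ∈ degreeLT F n := by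
  have h := degreeLT_mapCoeffs (mem_degreeLT_of_monic hp hn)
  rw [mem_degreeLT, degree_lt_iff_coeff_zero] at *
  intro k hk
  rcases hk.eq_or_lt with rfl | hk
  · rw [Differential.coeff_mapCoeffs, ← hn, hp.coeff_natDegree, Derivation.map_one_eq_zero]
  · exact h k hk

end DifferentialOperators

section Dressing

variable {F : Type*} [Field F] [Differential F] (h : ℤ → F)

/-- The monic differential operators of order `m` annihilating `h 1, h 3, …, h (2 * m - 1)`,
built one first-order factor at a time. -/
noncomputable def dressing : ℕ → F[X]
  | 0 => 1
  | m + 1 =>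
    X * dressing m + Differential.mapCoeffs (dressing m) -
      C ((diffOp (h (2 * m + 1)) (dressing m))′ / diffOp (h (2 * m + 1)) (dressing m)) * dressing m

/-- The value of the `m`-th dressing operator at `h (2 * m + 1)`. -/
noncomputable def dressingValue (m : ℕ) : F := diffOp (h (2 * m + 1)) (dressing h m)

theorem dressing_succ (m : ℕ) :
    dressing h (m + 1) = X * dressing h m + Differential.mapCoeffs (dressing h m) -
      C ((dressingValue h m)′ / dressingValue h m) * dressing h m := rfl

theorem diffOp_dressing_succ (m : ℕ) (f : F) :
    diffOp f (dressing h (m + 1)) = (diffOp f (dressing h m))′ -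
      (dressingValue h m)′ / dressingValue h m * diffOp f (dressing h m) := by
  rw [dressing_succ, map_sub, map_add, diffOp_X_mul, diffOp_mapCoeffs, diffOp_C_mul]
  ring

theorem monic_dressing_and_natDegree (m : ℕ) :
    (dressing h m).Monic ∧ (dressing h m).natDegree = m := by
  induction m with
  | zero => exact ⟨monic_one, natDegree_one⟩
  | succ m ih =>
    obtain ⟨hm, hd⟩ := ih
    have hlow : Differential.mapCoeffs (dressing h m) -
        C ((dressingValue h m)′ / dressingValue h m) * dressing h m ∈ degreeLT F (m + 1) :=
      Submodule.sub_mem _ (degreeLT_mapCoeffs (mem_degreeLT_of_monic hm hd))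
        (degreeLT_C_mul _ (mem_degreeLT_of_monic hm hd))
    have hX : (X * dressing h m).Monic := monic_X.mul hm
    have hXd : (X * dressing h m).natDegree = m + 1 := by
      rw [natDegree_X_mul hm.ne_zero, hd]
    have hlt : (Differential.mapCoeffs (dressing h m) -
        C ((dressingValue h m)′ / dressingValue h m) * dressing h m).degree <
          (X * dressing h m).degree := by
      rw [degree_eq_natDegree hX.ne_zero, hXd]
      exact mem_degreeLT.1 hlow
    rw [dressing_succ, add_sub_assoc]
    exact ⟨hX.add_of_left hlt, by rw [natDegree_add_eq_left_of_degree_lt hlt, hXd]⟩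

theorem monic_dressing (m : ℕ) : (dressing h m).Monic := (monic_dressing_and_natDegree h m).1

theorem natDegree_dressing (m : ℕ) : (dressing h m).natDegree = m :=
  (monic_dressing_and_natDegree h m).2

theorem dressing_mem_degreeLT (m : ℕ) : dressing h m ∈ degreeLT F (m + 1) :=
  mem_degreeLT_of_monic (monic_dressing h m) (natDegree_dressing h m)

theorem mapCoeffs_dressing_mem_degreeLT (m : ℕ) :
    Differential.mapCoeffs (dressing h m) ∈ degreeLT F m :=
  mapCoeffs_mem_degreeLT_of_monic (monic_dressing h m) (natDegree_dressing h m)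

theorem coeff_dressing_self (m : ℕ) : (dressing h m).coeff m = 1 := by
  have := (monic_dressing h m).coeff_natDegree
  rwa [natDegree_dressing] at this

variable {h}

theorem diffOp_dressing_eq_zero {m : ℕ} (ha : ∀ i < m, dressingValue h i ≠ 0) {i : ℕ}
    (hi : i < m) : diffOp (h (2 * i + 1)) (dressing h m) = 0 := by
  induction m with
  | zero => omega
  | succ m ih =>
    rw [diffOp_dressing_succ]
    rcases (Nat.lt_succ_iff.1 hi).eq_or_lt with rfl | hi
    · rw [← dressingValue, div_mul_cancel₀ _ (ha i (by omega)), sub_self]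
    · rw [ih (fun j hj => ha j (by omega)) hi, map_zero, mul_zero, sub_zero]

theorem eq_zero_of_diffOp_eq_zero {m : ℕ} (ha : ∀ i < m, dressingValue h i ≠ 0) {N : F[X]}
    (hN : N ∈ degreeLT F m) (hz : ∀ i < m, diffOp (h (2 * i + 1)) N = 0) : N = 0 := by
  induction m generalizing N with
  | zero =>
    rw [mem_degreeLT] at hN
    exact degree_eq_bot.1 (Nat.WithBot.lt_zero_iff.1 (by simpa using hN))
  | succ m ih =>
    have key : N - C (N.coeff m) * dressing h m = 0 := by
      refine ih (fun i hi => ha i (by omega))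
        (sub_coeff_mul_mem_degreeLT hN (monic_dressing h m) (natDegree_dressing h m)) ?_
      intro i hi
      rw [map_sub, diffOp_C_mul, hz i (by omega),
        diffOp_dressing_eq_zero (fun j hj => ha j (by omega)) hi, mul_zero, sub_zero]
    have h0 := congrArg (diffOp (h (2 * m + 1))) key
    rw [map_sub, diffOp_C_mul, hz m (by omega), map_zero, zero_sub, neg_eq_zero,
      ← dressingValue] at h0
    rw [(mul_eq_zero.1 h0).resolve_right (ha m (by omega)), C_0, zero_mul, sub_zero] at key
    exact key

theorem exists_eq_C_mul_dressing {m : ℕ} (ha : ∀ i < m, dressingValue h i ≠ 0) {N : F[X]}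
    (hN : N ∈ degreeLT F (m + 1)) (hz : ∀ i < m, diffOp (h (2 * i + 1)) N = 0) :
    ∃ c, N = C c * dressing h m := by
  refine ⟨N.coeff m, sub_eq_zero.1 (eq_zero_of_diffOp_eq_zero ha
    (sub_coeff_mul_mem_degreeLT hN (monic_dressing h m) (natDegree_dressing h m)) ?_)⟩
  intro i hi
  rw [map_sub, diffOp_C_mul, hz i hi, diffOp_dressing_eq_zero ha hi, mul_zero, sub_zero]

theorem coeff_dressing_succ {T : ℕ → F} (hT0 : T 0 = 1) {m : ℕ}
    (hT : ∀ i ≤ m, T (i + 1) = dressingValue h i * T i) (hne : ∀ i ≤ m + 1, T i ≠ 0) :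
    (dressing h (m + 1)).coeff m = -((T (m + 1))′ / T (m + 1)) := by
  induction m with
  | zero =>
    have h1 := hT 0 le_rfl
    rw [hT0, mul_one] at h1
    simp [dressing, dressingValue, h1]
  | succ m ih =>
    have h1 := hne (m + 1) (by omega)
    have h2 := hne (m + 2) (by omega)
    rw [hT (m + 1) le_rfl] at h2 ⊢
    have ha := left_ne_zero_of_mul h2
    rw [dressing_succ, coeff_sub, coeff_add, coeff_X_mul, coeff_C_mul,
      Differential.coeff_mapCoeffs, ih (fun i hi => hT i (by omega)) fun i hi => hne i (by omega),
      coeff_dressing_self, Derivation.map_one_eq_zero, Derivation.leibniz, smul_eq_mul, smul_eq_mul]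
    field_simp
    ring

theorem diffOp_deriv_deriv_eq_zero (hd : ∀ k, (h k)′ = h (k - 1))
    (hneg : ∀ k < 0, h k = 0) {p : F[X]} {m : ℕ}
    (hp : ∀ i < m, diffOp (h (2 * i + 1)) p = 0) {i : ℕ} (hi : i < m + 1) :
    diffOp (h (2 * i + 1))′′ p = 0 := by
  rw [hd, hd]
  rcases i with _ | i
  · rw [hneg _ (by norm_num), diffOp_zero_apply]
  · rw [← hp i (by omega),
      show 2 * ((i + 1 : ℕ) : ℤ) + 1 - 1 - 1 = 2 * (i : ℤ) + 1 by push_cast; ring]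

end Dressing

section Recurrence

variable {F : Type*} [Field F] [Differential F] {h : ℤ → F}

/-- The potential of the Schrödinger operator `∂² + U` intertwined with `∂²` by
`dressing h (m + 1)`. -/
noncomputable def dressingPotential (h : ℤ → F) (m : ℕ) : F :=
  -2 * ((dressing h (m + 1)).coeff m)′

theorem dressing_intertwines (hd : ∀ k, (h k)′ = h (k - 1)) (hneg : ∀ k < 0, h k = 0) {m : ℕ}
    (ha : ∀ i < m + 1, dressingValue h i ≠ 0) :
    2 * (X * Differential.mapCoeffs (dressing h (m + 1))) +
      Differential.mapCoeffs (Differential.mapCoeffs (dressing h (m + 1))) +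
      C (dressingPotential h m) * dressing h (m + 1) = 0 := by
  set K := dressing h (m + 1) with hK
  have hK' : Differential.mapCoeffs K ∈ degreeLT F (m + 1) := mapCoeffs_dressing_mem_degreeLT h _
  have hmem : 2 * (X * Differential.mapCoeffs K) +
      Differential.mapCoeffs (Differential.mapCoeffs K) +
      C (dressingPotential h m) * K ∈ degreeLT F (m + 1 + 1) := by
    refine Submodule.add_mem _ (Submodule.add_mem _ ?_ ?_)
      (degreeLT_C_mul _ (dressing_mem_degreeLT h _))
    · rw [two_mul]
      exact Submodule.add_mem _ (degreeLT_X_mul hK') (degreeLT_X_mul hK')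
    · exact degreeLT_mono (by omega) (degreeLT_mapCoeffs hK')
  obtain ⟨c, hc⟩ := exists_eq_C_mul_dressing ha hmem (by
    intro i hi
    have e1 : diffOp (h (2 * i + 1)) K = 0 := diffOp_dressing_eq_zero ha hi
    have e2 : diffOp (h (2 * i + 1))′′ K = 0 :=
      diffOp_deriv_deriv_eq_zero hd hneg (fun i hi => diffOp_dressing_eq_zero ha hi) (by omega)
    rw [two_mul (X * _)]
    simp only [map_add, diffOp_X_mul, diffOp_mapCoeffs, diffOp_C_mul, map_sub, e1, e2, map_zero]
    ring)
  have hcoeff := congrArg (fun p => p.coeff (m + 1)) hc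
  have h1 : (Differential.mapCoeffs K).coeff (m + 1) = 0 := by
    rw [mem_degreeLT, degree_lt_iff_coeff_zero] at hK'
    exact hK' _ le_rfl
  have h2 : K.coeff (m + 1) = 1 := coeff_dressing_self h _
  rw [two_mul (X * _)] at hcoeff
  simp only [coeff_add, coeff_X_mul, coeff_C_mul, Differential.coeff_mapCoeffs, h2,
    dressingPotential, ← hK, Derivation.map_one_eq_zero, map_zero] at hcoeff
  have hc0 : c = 0 := by linear_combination -hcoeff
  rw [hc, hc0, C_0, zero_mul]

theorem eq_X_mul_divX_of_diffOp_eq_zero {f : F} (hf : f ≠ 0) (hf' : f′ = 0) {p : F[X]}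
    (hp : diffOp f p = 0) : p = X * p.divX := by
  have key := p.X_mul_divX_add
  rw [← key, map_add, diffOp_X_mul, hf', diffOp_zero_apply, zero_add, ← monomial_zero_left,
    diffOp_monomial, Function.iterate_zero, id, mul_eq_zero] at hp
  rw [hp.resolve_right hf, C_0, add_zero] at key
  exact key.symm

theorem diffOp_dressing_ne_zero (hd : ∀ k, (h k)′ = h (k - 1)) (hneg : ∀ k < 0, h k = 0)
    (h0 : h 0 = 1) {m : ℕ} (ha : ∀ i < m + 1, dressingValue h i ≠ 0) :
    diffOp (h 0) (dressing h (m + 1)) ≠ 0 := by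
  have hf : h 0 ≠ 0 := by rw [h0]; exact one_ne_zero
  have hf' : (h 0)′ = 0 := by rw [hd, hneg _ (by norm_num)]
  intro hz
  set K := dressing h (m + 1) with hK
  have hG := eq_X_mul_divX_of_diffOp_eq_zero hf hf' hz
  have hGz (i : ℕ) (hi : i < m + 1) : diffOp (h (2 * i)) K.divX = 0 := by
    have := diffOp_dressing_eq_zero ha hi
    rwa [← hK, hG, diffOp_X_mul, hd, add_sub_cancel_right] at this
  have hG2 := eq_X_mul_divX_of_diffOp_eq_zero hf hf' (by simpa using hGz 0 (by omega))
  have hzero : K.divX.divX = 0 := by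
    refine eq_zero_of_diffOp_eq_zero (fun i hi => ha i (by omega))
      (divX_mem_degreeLT (divX_mem_degreeLT (dressing_mem_degreeLT h _))) fun i hi => ?_
    have := hGz (i + 1) (by omega)
    rwa [hG2, diffOp_X_mul, hd,
      show 2 * ((i + 1 : ℕ) : ℤ) - 1 = 2 * (i : ℤ) + 1 by push_cast; ring] at this
  rw [hzero, mul_zero] at hG2
  rw [hG2, mul_zero] at hG
  exact (monic_dressing h (m + 1)).ne_zero hG

/-- The Wronskian of the images of `h 0` and `h (2 * m + 3)` under a dressing operator. -/
theorem dressing_wronskian (hd : ∀ k, (h k)′ = h (k - 1)) (hneg : ∀ k < 0, h k = 0)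
    (h0 : h 0 = 1) {m : ℕ} (ha : ∀ i < m + 1, dressingValue h i ≠ 0) :
    diffOp (h 0) (dressing h (m + 1)) * (dressingValue h (m + 1))′ -
      (diffOp (h 0) (dressing h (m + 1)))′ * dressingValue h (m + 1) =
      diffOp (h 0) (dressing h (m + 1)) * dressingValue h m := by
  have hf' : (h 0)′ = 0 := by rw [hd, hneg _ (by norm_num)]
  have hb := diffOp_dressing_ne_zero hd hneg h0 ha
  unfold dressingValue
  set K := dressing h (m + 1) with hK
  set b := diffOp (h 0) K with hbdef
  have hmem : C b * (X * K + Differential.mapCoeffs K) - C b′ * K -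
      C b * (X * (X * dressing h m)) ∈ degreeLT F (m + 1 + 1) := by
    have e : C b * (X * K + Differential.mapCoeffs K) - C b′ * K -
        C b * (X * (X * dressing h m)) =
      C b * (X * (K - C (K.coeff (m + 1)) * (X * dressing h m)) +
        Differential.mapCoeffs K) - C b′ * K := by
      rw [hK, coeff_dressing_self, C_1]
      ring
    rw [e]
    refine Submodule.sub_mem _ (degreeLT_C_mul _ (Submodule.add_mem _ (degreeLT_X_mul ?_) ?_))
      (degreeLT_C_mul _ (dressing_mem_degreeLT h _))
    · exact sub_coeff_mul_mem_degreeLT (dressing_mem_degreeLT h _)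
        (monic_X.mul (monic_dressing h m))
        (by rw [natDegree_X_mul (monic_dressing h m).ne_zero, natDegree_dressing])
    · exact degreeLT_mono (by omega) (mapCoeffs_dressing_mem_degreeLT h (m + 1))
  have happly (f : F) : diffOp f (C b * (X * K + Differential.mapCoeffs K) - C b′ * K -
      C b * (X * (X * dressing h m))) =
      b * (diffOp f K)′ - b′ * diffOp f K - b * diffOp f′′ (dressing h m) := by
    simp only [map_sub, map_add, diffOp_C_mul, diffOp_X_mul, diffOp_mapCoeffs]
    ring
  obtain ⟨c, hc⟩ := exists_eq_C_mul_dressing ha hmem (by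
    intro i hi
    rw [happly, diffOp_dressing_eq_zero ha hi, diffOp_deriv_deriv_eq_zero hd hneg
      (fun j hj => diffOp_dressing_eq_zero (fun i hi => ha i (by omega)) hj) hi]
    simp)
  have hc0 := congrArg (diffOp (h 0)) hc
  rw [happly, hf', map_zero, diffOp_zero_apply, diffOp_C_mul, ← hK, ← hbdef] at hc0
  have hc1 : c = 0 := by
    refine (mul_eq_zero.1 ?_).resolve_right hb
    linear_combination -hc0
  have key := congrArg (diffOp (h (2 * ((m + 1 : ℕ) : ℤ) + 1))) hc
  rw [happly, hc1, C_0, zero_mul, map_zero, hd, hd,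
    show 2 * ((m + 1 : ℕ) : ℤ) + 1 - 1 - 1 = 2 * (m : ℤ) + 1 by push_cast; ring] at key
  linear_combination key

/-- The dressing operators conjugate `x∂ - 4t∂³ - 16∂⁵` to an operator acting on solutions of the
Schrödinger equation as a first-order operator. -/
theorem dressing_euler {x t : F} (hx : x′ = 1) (ht : t′ = 0)
    (hd : ∀ k, (h k)′ = h (k - 1)) (hneg : ∀ k < 0, h k = 0)
    (hrec : ∀ k : ℤ, (k : F) * h k = x * h (k - 1) - 4 * t * h (k - 3) - 16 * h (k - 5))
    {m : ℕ} (ha : ∀ i < m + 1, dressingValue h i ≠ 0) :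
    ∃ c : F, ∀ k : ℤ, diffOp (h (k - 2)) (dressing h (m + 1)) = 0 →
      diffOp (h (k - 4)) (dressing h (m + 1)) = 0 →
      (k : F) * diffOp (h k) (dressing h (m + 1)) =
        (x - 2 * t * dressingPotential h m -
          2 * ((dressingPotential h m)′′ + 3 * dressingPotential h m ^ 2)) *
            (diffOp (h k) (dressing h (m + 1)))′ + c * diffOp (h k) (dressing h (m + 1)) := by
  have hR := dressing_intertwines hd hneg ha
  set K := dressing h (m + 1) with hK
  set U := dressingPotential h m
  set q := x - 2 * t * U - 2 * (U′′ + 3 * U ^ 2) with hq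
  have hR1 := congrArg Differential.mapCoeffs hR
  have hR2 := congrArg Differential.mapCoeffs hR1
  have hmap2 : Differential.mapCoeffs (2 : F[X]) = 0 :=
    Derivation.map_natCast Differential.mapCoeffs 2
  simp only [map_add, map_zero, Derivation.leibniz, smul_eq_mul, Differential.mapCoeffs_X,
    Differential.mapCoeffs_C, mul_zero, add_zero, hmap2] at hR1 hR2
  set K1 := Differential.mapCoeffs K
  set K2 := Differential.mapCoeffs K1
  set K3 := Differential.mapCoeffs K2
  set K4 := Differential.mapCoeffs K3
  let N : F[X] := X * (C x * K + derivative K) - 4 * C t * (X * (X * (X * K))) -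
    16 * (X * (X * (X * (X * (X * K))))) - C q * (X * K + K1) +
    X * (X * (C (4 * t) * (X * K + K1) + 16 * (X * (X * (X * K + K1))) +
      C (8 * U) * (X * K + K1) - C (4 * U′) * K))
  have hN : N = X * derivative K - C q * K1 + C (-2 * t - 8 * U) * (X * K2) +
      C (-4 * U′) * (X * K1) + C (-2) * (X * K4) := by
    simp only [N, hq, map_sub, map_add, map_mul, map_pow, map_neg, map_ofNat]
    linear_combination (2 * C t * X + 8 * X ^ 3 + 6 * C U * X) * hR - 4 * X ^ 2 * hR1 +
      2 * X * hR2
  have hK1 : K1 ∈ degreeLT F (m + 1) := mapCoeffs_dressing_mem_degreeLT h (m + 1)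
  have hmem : N ∈ degreeLT F (m + 1 + 1) := by
    rw [hN]
    refine Submodule.add_mem _ (Submodule.add_mem _ (Submodule.add_mem _
      (Submodule.sub_mem _ (degreeLT_X_mul ?_) (degreeLT_C_mul _ (degreeLT_mono (by omega) hK1)))
      (degreeLT_C_mul _ (degreeLT_X_mul ?_))) (degreeLT_C_mul _ (degreeLT_X_mul hK1)))
      (degreeLT_C_mul _ (degreeLT_X_mul ?_))
    · rw [mem_degreeLT]
      have h1 := degree_derivative_lt (monic_dressing h (m + 1)).ne_zero
      rwa [degree_eq_natDegree (monic_dressing h (m + 1)).ne_zero, natDegree_dressing] at h1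
    · exact degreeLT_mapCoeffs hK1
    · exact degreeLT_mapCoeffs (degreeLT_mapCoeffs (degreeLT_mapCoeffs hK1))
  have happly (k : ℤ) (h2 : diffOp (h (k - 2)) K = 0) (h4 : diffOp (h (k - 4)) K = 0) :
      diffOp (h k) N = k * diffOp (h k) K - q * (diffOp (h k) K)′ := by
    have hkc : ((k : F))′ = 0 := Derivation.map_intCast _ k
    have h4c : ((4 : F))′ = 0 := Derivation.map_natCast _ 4
    have h16c : ((16 : F))′ = 0 := Derivation.map_natCast _ 16
    have h4t : (4 * t)′ = 0 := by simp [ht, h4c]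
    have hE : (k : F) * h k + (4 * t * h (k - 3) + 16 * h (k - 5)) = x * h (k - 1) := by
      rw [hrec]
      ring
    have hE' := congrArg (fun f => diffOp f K) hE
    simp only [diffOp_add_apply, diffOp_const_mul_apply hkc, diffOp_const_mul_apply h4t,
      diffOp_const_mul_apply h16c, diffOp_coordinate_mul_apply hx] at hE'
    have e4 : (4 : F[X]) * C t = C (4 * t) := by rw [C_mul, map_ofNat]
    have e16 : (16 : F[X]) = C 16 := (map_ofNat C 16).symm
    simp only [N, e4]
    simp only [e16, map_sub, map_add, diffOp_C_mul, diffOp_X_mul, K1, diffOp_mapCoeffs,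
      mul_assoc, hd, sub_sub]
    norm_num [h2, h4]
    linear_combination -hE'
  obtain ⟨c, hc⟩ := exists_eq_C_mul_dressing ha hmem (by
    intro i hi
    have hvanish (j : ℕ) : diffOp (h (2 * i + 1 - 2 * j)) K = 0 := by
      rcases le_or_gt j i with hj | hj
      · have := diffOp_dressing_eq_zero ha (show i - j < m + 1 by omega)
        rwa [Nat.cast_sub hj, show 2 * ((i : ℤ) - j) + 1 = 2 * i + 1 - 2 * j by ring] at this
      · rw [hneg _ (by omega), diffOp_zero_apply]
    rw [happly _ (hvanish 1) (hvanish 2)]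
    have h3 := hvanish 0
    rw [Nat.cast_zero, mul_zero, sub_zero] at h3
    rw [h3, map_zero, mul_zero, mul_zero, sub_zero])
  refine ⟨c, fun k h2 h4 => ?_⟩
  have := happly k h2 h4
  rw [hc, diffOp_C_mul] at this
  linear_combination -this

/-- Ratios of consecutive values `dressingValue h m`, in terms of the potential. -/
theorem dressingValue_succ {x t : F} (hx : x′ = 1) (ht : t′ = 0)
    (hd : ∀ k, (h k)′ = h (k - 1)) (hneg : ∀ k < 0, h k = 0) (h0 : h 0 = 1)
    (hrec : ∀ k : ℤ, (k : F) * h k = x * h (k - 1) - 4 * t * h (k - 3) - 16 * h (k - 5))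
    {m : ℕ} (ha : ∀ i < m + 1, dressingValue h i ≠ 0) :
    (2 * (m + 1) + 1) * dressingValue h (m + 1) =
      (x - 2 * t * dressingPotential h m -
        2 * ((dressingPotential h m)′′ + 3 * dressingPotential h m ^ 2)) * dressingValue h m := by
  obtain ⟨c, hc⟩ := dressing_euler hx ht hd hneg hrec ha
  have hW := dressing_wronskian hd hneg h0 ha
  have hb := diffOp_dressing_ne_zero hd hneg h0 ha
  have e0 := hc 0 (by rw [hneg _ (by norm_num), diffOp_zero_apply])
    (by rw [hneg _ (by norm_num), diffOp_zero_apply])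
  have hvanish (j : ℕ) (hj : 1 ≤ j) :
      diffOp (h (2 * ((m + 1 : ℕ) : ℤ) + 1 - 2 * j)) (dressing h (m + 1)) = 0 := by
    rcases le_or_gt j (m + 1) with hj' | hj'
    · have := diffOp_dressing_eq_zero ha (show m + 1 - j < m + 1 by omega)
      rwa [Nat.cast_sub hj', show 2 * (((m + 1 : ℕ) : ℤ) - j) + 1 =
        2 * ((m + 1 : ℕ) : ℤ) + 1 - 2 * j by ring] at this
    · rw [hneg _ (by omega), diffOp_zero_apply]
  have e1 := hc _ (hvanish 1 le_rfl) (hvanish 2 (by norm_num))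
  rw [← dressingValue] at e1
  push_cast at e0 e1
  refine mul_left_cancel₀ hb ?_
  linear_combination diffOp (h 0) (dressing h (m + 1)) * e1 - dressingValue h (m + 1) * e0 +
    (x - 2 * t * dressingPotential h m -
        2 * ((dressingPotential h m)′′ + 3 * dressingPotential h m ^ 2)) * hW

end Recurrence

section FractionField

/-- The derivation of `ℂ[X]` extends to its fraction field. -/
theorem exists_differential_isFractionRing (F : Type*) [Field F] [Algebra ℂ[X] F]
    [IsFractionRing ℂ[X] F] :
    ∃ _ : Differential F, ∀ p : ℂ[X],
      (algebraMap ℂ[X] F p)′ = algebraMap ℂ[X] F (derivative p) := by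
  let φ := algebraMap ℂ[X] F
  let g : ℂ[X] →+* TrivSqZeroExt F F :=
    { toFun := fun p => TrivSqZeroExt.inl (φ p) + TrivSqZeroExt.inr (φ (derivative p))
      map_one' := by ext <;> simp
      map_zero' := by ext <;> simp
      map_add' := fun p q => by ext <;> simp
      map_mul' := fun p q => by
        ext
        · simp
        · simp
          ring }
  have hg (y : nonZeroDivisors ℂ[X]) : IsUnit (g y) := by
    rw [TrivSqZeroExt.isUnit_iff_isUnit_fst]
    simpa only [g, RingHom.coe_mk, MonoidHom.coe_mk, OneHom.coe_mk, TrivSqZeroExt.fst_add,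
      TrivSqZeroExt.fst_inl, TrivSqZeroExt.fst_inr, add_zero] using IsLocalization.map_units F y
  let G := IsLocalization.lift (S := F) hg
  have hGφ (p : ℂ[X]) : G (φ p) = g p := IsLocalization.lift_eq hg p
  have hfst : (TrivSqZeroExt.fstHom F F F).toRingHom.comp G = RingHom.id _ := by
    refine IsLocalization.ringHom_ext (nonZeroDivisors ℂ[X]) ?_
    refine RingHom.ext fun p => ?_
    change (G (φ p)).fst = φ p
    rw [hGφ]
    simp [g]
  have hfst' (y : F) : (G y).fst = y := congrArg (fun f => f y) hfst
  refine ⟨⟨Derivation.mk' (AddMonoidHom.toIntLinearMap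
    { toFun := fun y => (G y).snd
      map_zero' := by simp
      map_add' := fun y z => by simp }) fun y z => ?_⟩, fun p => ?_⟩
  · simp only [AddMonoidHom.coe_toIntLinearMap, AddMonoidHom.coe_mk, ZeroHom.coe_mk, map_mul,
      TrivSqZeroExt.snd_mul, hfst', MulOpposite.smul_eq_mul_unop, MulOpposite.unop_op, smul_eq_mul]
    ring
  · change (G (φ p)).snd = φ (derivative p)
    rw [hGφ]
    simp [g]

end FractionField

section Determinant

variable {F : Type*} [Field F] [Differential F] {h : ℤ → F}

theorem iterate_deriv_eq (hd : ∀ k, (h k)′ = h (k - 1)) (n : ℕ) (k : ℤ) :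
    Differential.deriv^[n] (h k) = h (k - n) := by
  induction n with
  | zero => simp
  | succ n ih =>
    rw [Function.iterate_succ_apply', ih, hd]
    congr 1
    push_cast
    ring

theorem diffOp_eq_sum (hd : ∀ k, (h k)′ = h (k - 1)) {m : ℕ} {p : F[X]}
    (hp : p ∈ degreeLT F (m + 1)) (k : ℤ) :
    diffOp (h k) p = ∑ j : Fin (m + 1), p.coeff (m - j) * h (k - m + j) := by
  have hdeg : p.natDegree < m + 1 := by
    rw [mem_degreeLT, degree_lt_iff_coeff_zero] at hp
    exact Nat.lt_succ_iff.2 (natDegree_le_iff_coeff_eq_zero.2 fun k hk => hp k hk)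
  rw [p.as_sum_range' _ hdeg, map_sum, ← p.as_sum_range' _ hdeg, ← Finset.sum_range_reflect,
    ← Fin.sum_univ_eq_sum_range]
  refine Finset.sum_congr rfl fun j _ => ?_
  have hj : (j : ℕ) ≤ m := by omega
  rw [add_tsub_cancel_right, diffOp_monomial, iterate_deriv_eq hd, Nat.cast_sub hj]
  congr 2
  ring

theorem det_succ_eq_dressingValue_mul (hd : ∀ k, (h k)′ = h (k - 1)) {m : ℕ}
    (ha : ∀ i < m, dressingValue h i ≠ 0) :
    (Matrix.of fun i j : Fin (m + 1) =>
      h (((m + 1 : ℕ) : ℤ) + ((j : ℕ) : ℤ) - 2 * ((i : ℕ) : ℤ))).det =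
    dressingValue h m *
      (Matrix.of fun i j : Fin m => h ((m : ℤ) + ((j : ℕ) : ℤ) - 2 * ((i : ℕ) : ℤ))).det := by
  have hcol := Matrix.det_updateCol_sum (Matrix.of fun i j : Fin (m + 1) =>
      h (((m + 1 : ℕ) : ℤ) + ((j : ℕ) : ℤ) - 2 * ((i : ℕ) : ℤ))) 0
      (fun j => (dressing h m).coeff (m - j))
  have hentry (i : Fin (m + 1)) : ∑ j : Fin (m + 1), (dressing h m).coeff (m - j) •
      (Matrix.of fun i j : Fin (m + 1) =>
        h (((m + 1 : ℕ) : ℤ) + ((j : ℕ) : ℤ) - 2 * ((i : ℕ) : ℤ))) i j =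
      diffOp (h (2 * m + 1 - 2 * i)) (dressing h m) := by
    rw [diffOp_eq_sum hd (dressing_mem_degreeLT h m)]
    refine Finset.sum_congr rfl fun j _ => ?_
    rw [smul_eq_mul, Matrix.of_apply]
    congr 2
    push_cast
    ring
  simp only [hentry] at hcol
  rw [Fin.val_zero, Nat.sub_zero, coeff_dressing_self, one_smul] at hcol
  rw [← hcol, Matrix.det_succ_column_zero, Finset.sum_eq_single 0]
  · simp only [Matrix.updateCol_self, Fin.val_zero, pow_zero, one_mul, Nat.cast_zero, mul_zero,
      sub_zero]
    rw [dressingValue]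
    congr 2
    ext i j
    simp only [Matrix.submatrix_apply, Fin.succAbove_zero,
      Matrix.updateCol_ne (Fin.succ_ne_zero _), Matrix.of_apply, Fin.val_succ]
    congr 1
    push_cast
    ring
  · intro i _ hi
    obtain ⟨j, rfl⟩ := Fin.exists_succ_eq.2 hi
    have hz := diffOp_dressing_eq_zero ha (show m - 1 - j < m by omega)
    rw [Matrix.updateCol_self,
      show 2 * (m : ℤ) + 1 - 2 * ((j.succ : ℕ) : ℤ) = 2 * ((m - 1 - j : ℕ) : ℤ) + 1 by
        rw [Fin.val_succ]; omega, hz]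
    simp
  · simp

end Determinant

section CompleteHomogeneous

/-- The triples of exponents contributing to `painleveH2 t₁ k`. -/
def weightTriples (k : ℤ) : Finset ((ℕ × ℕ) × ℕ) :=
  if k < 0 then ∅
  else ((Finset.range (k.toNat + 1) ×ˢ Finset.range (k.toNat + 1)) ×ˢ
      Finset.range (k.toNat + 1)).filter (fun p => p.1.1 + 3 * p.1.2 + 5 * p.2 = k.toNat)

theorem mem_weightTriples {k : ℤ} {p : (ℕ × ℕ) × ℕ} :
    p ∈ weightTriples k ↔ (p.1.1 : ℤ) + 3 * p.1.2 + 5 * p.2 = k := by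
  unfold weightTriples
  split_ifs with hk
  · simp only [Finset.notMem_empty, false_iff]
    omega
  · simp only [Finset.mem_filter, Finset.mem_product, Finset.mem_range]
    omega

/-- The summands of `painleveH2 t₁ k`. -/
noncomputable def weightTerm (t₁ : ℂ) (p : (ℕ × ℕ) × ℕ) : ℂ[X] :=
  C ((1 / ((Nat.factorial p.1.1 : ℂ) * (Nat.factorial p.1.2 : ℂ) * (Nat.factorial p.2 : ℂ))) *
    ((-4 : ℂ) * t₁ / 3) ^ p.1.2 * ((-16 : ℂ) / 5) ^ p.2) * X ^ p.1.1

theorem painleveH2_eq_sum (t₁ : ℂ) (k : ℤ) :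
    painleveH2 t₁ k = ∑ p ∈ weightTriples k, weightTerm t₁ p := by
  unfold painleveH2 weightTriples
  split_ifs with hk
  · simp
  · rfl

theorem painleveH2_of_neg (t₁ : ℂ) {k : ℤ} (hk : k < 0) : painleveH2 t₁ k = 0 := if_pos hk

theorem painleveH2_zero (t₁ : ℂ) : painleveH2 t₁ 0 = 1 := by
  have h : weightTriples 0 = {((0, 0), 0)} := by
    ext ⟨⟨i, j⟩, l⟩
    simp only [mem_weightTriples, Finset.mem_singleton, Prod.mk.injEq]
    omega
  simp [painleveH2_eq_sum, h, weightTerm]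

theorem derivative_weightTerm_succ (t₁ : ℂ) (i j l : ℕ) :
    derivative (weightTerm t₁ ((i + 1, j), l)) = weightTerm t₁ ((i, j), l) := by
  simp only [weightTerm, derivative_C_mul, derivative_X_pow, add_tsub_cancel_right, ← mul_assoc,
    ← C_mul]
  congr 2
  have := Nat.factorial_ne_zero i
  push_cast [Nat.factorial_succ]
  field_simp

theorem derivative_painleveH2 (t₁ : ℂ) (k : ℤ) :
    derivative (painleveH2 t₁ k) = painleveH2 t₁ (k - 1) := by
  rw [painleveH2_eq_sum, painleveH2_eq_sum, derivative_sum]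
  symm
  refine Finset.sum_of_injOn (fun p => ((p.1.1 + 1, p.1.2), p.2)) ?_ ?_ ?_ ?_
  · rintro ⟨⟨i, j⟩, l⟩ _ ⟨⟨i', j'⟩, l'⟩ _ h
    simpa using h
  · intro p hp
    rw [Finset.mem_coe, mem_weightTriples] at *
    push_cast
    linarith
  · rintro ⟨⟨i, j⟩, l⟩ hp hn
    rcases i with _ | i
    · rw [weightTerm, pow_zero, mul_one, derivative_C]
    · refine absurd ⟨((i, j), l), ?_, rfl⟩ hn
      rw [Finset.mem_coe, mem_weightTriples] at *
      push_cast at hp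
      linarith
  · rintro ⟨⟨i, j⟩, l⟩ _
    exact (derivative_weightTerm_succ t₁ i j l).symm

theorem natCast_mul_weightTerm_linear (t₁ : ℂ) (k : ℤ) :
    ∑ p ∈ weightTriples k, ((p.1.1 : ℕ) : ℂ[X]) * weightTerm t₁ p = X * painleveH2 t₁ (k - 1) := by
  rw [painleveH2_eq_sum, Finset.mul_sum]
  symm
  refine Finset.sum_of_injOn (fun p => ((p.1.1 + 1, p.1.2), p.2)) ?_ ?_ ?_ ?_
  · rintro ⟨⟨i, j⟩, l⟩ _ ⟨⟨i', j'⟩, l'⟩ _ h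
    simpa using h
  · intro p hp
    rw [Finset.mem_coe, mem_weightTriples] at *
    push_cast
    linarith
  · rintro ⟨⟨i, j⟩, l⟩ hp hn
    rcases i with _ | i
    · rw [Nat.cast_zero, zero_mul]
    · refine absurd ⟨((i, j), l), ?_, rfl⟩ hn
      rw [Finset.mem_coe, mem_weightTriples] at *
      push_cast at hp
      linarith
  · rintro ⟨⟨i, j⟩, l⟩ _
    rw [← derivative_weightTerm_succ, weightTerm, derivative_C_mul, derivative_X_pow,
      add_tsub_cancel_right, pow_succ]
    simp only [map_natCast]
    ring

theorem natCast_mul_weightTerm_cubic (t₁ : ℂ) (k : ℤ) :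
    ∑ p ∈ weightTriples k, ((3 * p.1.2 : ℕ) : ℂ[X]) * weightTerm t₁ p =
      -4 * C t₁ * painleveH2 t₁ (k - 3) := by
  rw [painleveH2_eq_sum, Finset.mul_sum]
  symm
  refine Finset.sum_of_injOn (fun p => ((p.1.1, p.1.2 + 1), p.2)) ?_ ?_ ?_ ?_
  · rintro ⟨⟨i, j⟩, l⟩ _ ⟨⟨i', j'⟩, l'⟩ _ h
    simpa using h
  · intro p hp
    rw [Finset.mem_coe, mem_weightTriples] at *
    push_cast
    linarith
  · rintro ⟨⟨i, j⟩, l⟩ hp hn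
    rcases j with _ | j
    · rw [mul_zero, Nat.cast_zero, zero_mul]
    · refine absurd ⟨((i, j), l), ?_, rfl⟩ hn
      rw [Finset.mem_coe, mem_weightTriples] at *
      push_cast at hp
      linarith
  · rintro ⟨⟨i, j⟩, l⟩ _
    simp only [weightTerm, ← map_natCast C, ← mul_assoc, ← C_mul]
    rw [← map_ofNat C 4, ← C_neg, ← C_mul, ← C_mul]
    congr 2
    have := Nat.factorial_ne_zero j
    push_cast [Nat.factorial_succ, pow_succ]
    field_simp

theorem natCast_mul_weightTerm_quintic (t₁ : ℂ) (k : ℤ) :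
    ∑ p ∈ weightTriples k, ((5 * p.2 : ℕ) : ℂ[X]) * weightTerm t₁ p =
      -16 * painleveH2 t₁ (k - 5) := by
  rw [painleveH2_eq_sum, Finset.mul_sum]
  symm
  refine Finset.sum_of_injOn (fun p => ((p.1.1, p.1.2), p.2 + 1)) ?_ ?_ ?_ ?_
  · rintro ⟨⟨i, j⟩, l⟩ _ ⟨⟨i', j'⟩, l'⟩ _ h
    simpa using h
  · intro p hp
    rw [Finset.mem_coe, mem_weightTriples] at *
    push_cast
    linarith
  · rintro ⟨⟨i, j⟩, l⟩ hp hn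
    rcases l with _ | l
    · rw [mul_zero, Nat.cast_zero, zero_mul]
    · refine absurd ⟨((i, j), l), ?_, rfl⟩ hn
      rw [Finset.mem_coe, mem_weightTriples] at *
      push_cast at hp
      linarith
  · rintro ⟨⟨i, j⟩, l⟩ _
    simp only [weightTerm, ← map_natCast C, ← mul_assoc, ← C_mul]
    rw [← map_ofNat C 16, ← C_neg, ← C_mul]
    congr 2
    have := Nat.factorial_ne_zero l
    push_cast [Nat.factorial_succ, pow_succ]
    field_simp

theorem intCast_mul_painleveH2 (t₁ : ℂ) (k : ℤ) :
    (k : ℂ[X]) * painleveH2 t₁ k = X * painleveH2 t₁ (k - 1) -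
      4 * C t₁ * painleveH2 t₁ (k - 3) - 16 * painleveH2 t₁ (k - 5) := by
  have h : (k : ℂ[X]) * painleveH2 t₁ k =
      X * painleveH2 t₁ (k - 1) + -4 * C t₁ * painleveH2 t₁ (k - 3) +
        -16 * painleveH2 t₁ (k - 5) := by
    rw [← natCast_mul_weightTerm_linear, ← natCast_mul_weightTerm_cubic,
      ← natCast_mul_weightTerm_quintic, ← Finset.sum_add_distrib, ← Finset.sum_add_distrib,
      painleveH2_eq_sum, Finset.mul_sum]
    refine Finset.sum_congr rfl fun p hp => ?_
    rw [← mem_weightTriples.1 hp]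
    push_cast
    ring
  linear_combination h

end CompleteHomogeneous

section TauFunction

theorem painleveTau2_zero (t₁ : ℂ) : painleveTau2 t₁ 0 = 1 := Matrix.det_isEmpty

theorem painleveTau2_one (t₁ : ℂ) : painleveTau2 t₁ 1 = X := by
  have h1 := intCast_mul_painleveH2 t₁ 1
  rw [sub_self, painleveH2_zero, painleveH2_of_neg t₁ (by norm_num : (1 - 3 : ℤ) < 0),
    painleveH2_of_neg t₁ (by norm_num : (1 - 5 : ℤ) < 0)] at h1
  simpa [painleveTau2] using h1

/-- The iterated derivatives of `S` in terms of its logarithmic derivative `L`. -/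
theorem iterated_deriv_of_deriv_eq_mul {F : Type*} [Field F] [Differential F] {S L : F}
    (d1 : S′ = L * S) :
    S′′ = (L′ + L ^ 2) * S ∧
      S′′′ = (L′′ + 3 * L * L′ + L ^ 3) * S ∧
      S′′′′ = (L′′′ + 4 * L * L′′ + 3 * L′ ^ 2 + 6 * L ^ 2 * L′ + L ^ 4) * S := by
  have h3 : ((3 : F))′ = 0 := Derivation.map_natCast _ 3
  have d2 : S′′ = (L′ + L ^ 2) * S := by
    rw [d1, Derivation.leibniz, d1, smul_eq_mul, smul_eq_mul]
    ring
  have d3 : S′′′ = (L′′ + 3 * L * L′ + L ^ 3) * S := by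
    rw [d2]
    simp only [Derivation.leibniz, map_add, Derivation.leibniz_pow, d1, smul_eq_mul, nsmul_eq_mul]
    norm_num
    ring
  refine ⟨d2, d3, ?_⟩
  rw [d3]
  simp only [Derivation.leibniz, map_add, Derivation.leibniz_pow, d1, smul_eq_mul, nsmul_eq_mul,
    h3]
  norm_num
  ring

/-- The bilinear recurrence of the generalized Yablonskii–Vorobiev polynomials, in the
normalization of the τ-functions. -/
theorem painleveTau2_recurrence (t₁ : ℂ) (m : ℕ) (hne : ∀ i ≤ m + 1, painleveTau2 t₁ i ≠ 0) :
    (2 * ((m : ℂ[X]) + 1) + 1) * (painleveTau2 t₁ (m + 2) * painleveTau2 t₁ m) =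
      X * painleveTau2 t₁ (m + 1) ^ 2 -
        4 * (painleveTau2 t₁ (m + 1) *
            derivative (derivative (derivative (derivative (painleveTau2 t₁ (m + 1))))) -
          4 * derivative (painleveTau2 t₁ (m + 1)) *
            derivative (derivative (derivative (painleveTau2 t₁ (m + 1)))) +
          3 * derivative (derivative (painleveTau2 t₁ (m + 1))) ^ 2) -
        4 * C t₁ * (painleveTau2 t₁ (m + 1) * derivative (derivative (painleveTau2 t₁ (m + 1))) -
          derivative (painleveTau2 t₁ (m + 1)) ^ 2) := by
  let F := FractionRing ℂ[X]
  obtain ⟨_, hder⟩ := exists_differential_isFractionRing F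
  have hinj : Function.Injective (algebraMap ℂ[X] F) := IsFractionRing.injective ℂ[X] F
  set φ := algebraMap ℂ[X] F with hφ
  let h : ℤ → F := fun k => φ (painleveH2 t₁ k)
  let T : ℕ → F := fun k => φ (painleveTau2 t₁ k)
  have hd (k : ℤ) : (h k)′ = h (k - 1) := by
    simp only [h, hder, derivative_painleveH2]
  have hneg (k : ℤ) (hk : k < 0) : h k = 0 := by
    simp only [h, painleveH2_of_neg t₁ hk, map_zero]
  have h0 : h 0 = 1 := by
    simp only [h, painleveH2_zero, map_one]
  have hx : (φ X)′ = 1 := by rw [hder, derivative_X, map_one]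
  have ht : (φ (C t₁))′ = 0 := by rw [hder, derivative_C, map_zero]
  have hrec (k : ℤ) : (k : F) * h k =
      φ X * h (k - 1) - 4 * φ (C t₁) * h (k - 3) - 16 * h (k - 5) := by
    have := congrArg φ (intCast_mul_painleveH2 t₁ k)
    simpa only [map_sub, map_mul, map_intCast, map_ofNat] using this
  have hTdet (k : ℕ) : T k =
      (Matrix.of fun i j : Fin k => h ((k : ℤ) + ((j : ℕ) : ℤ) - 2 * ((i : ℕ) : ℤ))).det := by
    simp only [T, painleveTau2, RingHom.map_det]
    rfl
  have hTne (i : ℕ) (hi : i ≤ m + 1) : T i ≠ 0 := fun hz =>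
    hne i hi ((map_eq_zero_iff φ hinj).1 hz)
  have hTsucc (k : ℕ) (ha : ∀ i < k, dressingValue h i ≠ 0) :
      T (k + 1) = dressingValue h k * T k := by
    rw [hTdet, hTdet, det_succ_eq_dressingValue_mul hd ha]
  have ha (i : ℕ) (hi : i < m + 1) : dressingValue h i ≠ 0 := by
    induction i using Nat.strong_induction_on with
    | _ i ih =>
      have := hTne (i + 1) hi
      rw [hTsucc i fun j hj => ih j hj (by omega)] at this
      exact left_ne_zero_of_mul this
  have hT (i : ℕ) (hi : i ≤ m + 1) : T (i + 1) = dressingValue h i * T i :=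
    hTsucc i fun j hj => ha j (by omega)
  have hU : dressingPotential h m = 2 * ((T (m + 1))′ / T (m + 1))′ := by
    rw [dressingPotential, coeff_dressing_succ (T := T)
      (by simp only [T, painleveTau2_zero, map_one]) (fun i hi => hT i (by omega)) hTne, map_neg]
    ring
  have key := dressingValue_succ hx ht hd hneg h0 hrec ha
  have e1 := hT m (by omega)
  have e2 := hT (m + 1) le_rfl
  set S := T (m + 1) with hS
  set L := S′ / S with hL
  have d1 : S′ = L * S := (div_mul_cancel₀ _ (hTne (m + 1) le_rfl)).symm
  obtain ⟨d2, d3, d4⟩ := iterated_deriv_of_deriv_eq_mul d1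
  have hU2 : (dressingPotential h m)′′ = 2 * L′′′ := by
    rw [hU, two_mul, map_add, map_add, two_mul]
  rw [hU2, hU] at key
  apply hinj
  have hS' : φ (painleveTau2 t₁ (m + 1)) = S := rfl
  have hT0 : φ (painleveTau2 t₁ m) = T m := rfl
  have hT2 : φ (painleveTau2 t₁ (m + 2)) = T (m + 1 + 1) := rfl
  simp only [map_sub, map_add, map_mul, map_pow, map_ofNat, map_one, map_natCast, ← hder, hS', hT0,
    hT2]
  rw [d4, d3, d2, d1, e2]
  linear_combination S * T m * key - (φ X - 2 * φ (C t₁) * (2 * L′) -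
    2 * (2 * L′′′ + 3 * (2 * L′) ^ 2)) * S * e1

end TauFunction

/-- The proportionality constants between the τ-functions and the generalized
Yablonskii–Vorobiev polynomials. -/
theorem prod_zpow_recurrence (m : ℕ) :
    (2 * ((m : ℚ) + 1) + 1) *
      ((∏ k ∈ Finset.Icc 1 (m + 2), (2 * (k : ℚ) + 1) ^ ((k : ℤ) - ((m + 2 : ℕ) : ℤ))) *
        ∏ k ∈ Finset.Icc 1 m, (2 * (k : ℚ) + 1) ^ ((k : ℤ) - (m : ℤ))) =
      (∏ k ∈ Finset.Icc 1 (m + 1), (2 * (k : ℚ) + 1) ^ ((k : ℤ) - ((m + 1 : ℕ) : ℤ))) ^ 2 := by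
  have hpos (k : ℕ) : (2 * (k : ℚ) + 1) ≠ 0 := by positivity
  have hm : (2 * ((m : ℚ) + 1) + 1) ≠ 0 := by positivity
  rw [Finset.prod_Icc_succ_top (by omega : 1 ≤ m + 1 + 1),
    Finset.prod_Icc_succ_top (by omega : 1 ≤ m + 1),
    Finset.prod_Icc_succ_top (by omega : 1 ≤ m + 1), sub_self, sub_self, zpow_zero, zpow_zero,
    mul_one, mul_one, ← Finset.prod_pow,
    show ((m + 1 : ℕ) : ℤ) - ((m + 2 : ℕ) : ℤ) = -1 by push_cast; ring, zpow_neg_one]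
  push_cast
  rw [mul_right_comm, ← Finset.prod_mul_distrib, mul_comm, mul_assoc, inv_mul_cancel₀ hm, mul_one]
  refine Finset.prod_congr rfl fun k _ => ?_
  rw [← zpow_add₀ (hpos k), ← zpow_natCast, ← zpow_mul]
  congr 1
  push_cast
  ring

/-- The τ-functions are proportional to the generalized Yablonskii–Vorobiev
polynomials, `τ_m = c_m·u_m` with `c_m = ∏_{k=1}^m (2k+1)^{k−m}` independent
of `t₁`. -/
theorem tau_eq_const_mul_YV (t₁ : ℂ) (u : ℕ → Polynomial ℂ)
    (hne : ∀ m, u m ≠ 0)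
    (h0 : u 0 = 1) (h1 : u 1 = X)
    (hrec : ∀ m : ℕ, 1 ≤ m →
      u (m + 1) * u (m - 1) =
        X * (u m) ^ 2 -
          4 * (u m * derivative (derivative (derivative (derivative (u m)))) -
            4 * derivative (u m) * derivative (derivative (derivative (u m))) +
            3 * (derivative (derivative (u m))) ^ 2) -
          4 * Polynomial.C t₁ *
            (u m * derivative (derivative (u m)) - (derivative (u m)) ^ 2)) :
    ∀ m : ℕ,
      painleveTau2 t₁ m =
        Polynomial.C
            (((∏ k ∈ Finset.Icc 1 m,
                (2 * (k : ℚ) + 1) ^ ((k : ℤ) - (m : ℤ))) : ℚ) : ℂ) *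
          u m := by
  suffices h : ∀ m, (∀ i ≤ m, painleveTau2 t₁ i = C (((∏ k ∈ Finset.Icc 1 i,
      (2 * (k : ℚ) + 1) ^ ((k : ℤ) - (i : ℤ))) : ℚ) : ℂ) * u i) by
    exact fun m => h m m le_rfl
  have hconst (i : ℕ) : (((∏ k ∈ Finset.Icc 1 i,
      (2 * (k : ℚ) + 1) ^ ((k : ℤ) - (i : ℤ))) : ℚ) : ℂ) ≠ 0 := by
    rw [Rat.cast_ne_zero]
    exact Finset.prod_ne_zero_iff.2 fun k _ => zpow_ne_zero _ (by positivity)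
  intro m
  induction m with
  | zero =>
    intro i hi
    rw [Nat.le_zero.1 hi, painleveTau2_zero, h0]
    simp
  | succ m ih =>
    intro i hi
    rcases hi.eq_or_lt with rfl | hi
    swap
    · exact ih i (by omega)
    rcases m with _ | m
    · rw [zero_add, painleveTau2_one, h1]
      simp
    have hτne (i : ℕ) (hi : i ≤ m + 1) : painleveTau2 t₁ i ≠ 0 := by
      rw [ih i hi]
      exact mul_ne_zero (C_ne_zero.2 (hconst i)) (hne i)
    have hτ := painleveTau2_recurrence t₁ m hτne
    have hu := hrec (m + 1) (by omega)
    rw [add_tsub_cancel_right] at hu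
    have hc := congrArg (fun q : ℚ => (C (q : ℂ) : ℂ[X])) (prod_zpow_recurrence m)
    simp only [Rat.cast_mul, Rat.cast_pow, C_mul, C_pow] at hc
    have hc' : C (((2 * ((m : ℚ) + 1) + 1 : ℚ)) : ℂ) = 2 * ((m : ℂ[X]) + 1) + 1 := by
      push_cast
      simp only [C_add, C_mul, map_ofNat, C_1, map_natCast]
    rw [hc'] at hc
    have hm : (2 * ((m : ℂ[X]) + 1) + 1) ≠ 0 := by
      rw [← hc', Ne, C_eq_zero, Rat.cast_eq_zero]
      positivity
    refine mul_right_cancel₀ (hτne m (by omega)) (mul_left_cancel₀ hm ?_)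
    rw [hτ, ih (m + 1) le_rfl, ih m (by omega)]
    simp only [derivative_C_mul]
    linear_combination -(u (m + 1 + 1) * u m) * hc -
      C (((∏ k ∈ Finset.Icc 1 (m + 1),
        (2 * (k : ℚ) + 1) ^ ((k : ℤ) - ((m + 1 : ℕ) : ℤ))) : ℚ) : ℂ) ^ 2 * hu
end

section
/- Let K be a field of characteristic zero with a derivation d, let z ∈ K satisfy d z = 1, and let α ∈ K be constant. Given w ∈ K, define Q := 4w, f₀ := (1/2)(d w − w² − z/2), f₁ := −(1/2)(d w + w² + z/2), β₀ := 2α − 1, and β₁ := −2α − 1 (so that β₀ + β₁ = −2). Then w satisfies the second Painlevé equation d²w = 2w³ + z·w + α if and only if the symmetric system holds: d f₀ = −(1/2)·Q·f₀ + (1/4)·β₀, d f₁ = (1/2)·Q·f₁ + (1/4)·β₁, and d Q = 4(f₀ − f₁). -/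
/-- The symmetric form of the second Painlevé equation: `w` solves
`d²w = 2w³ + z·w + α` if and only if `(f₀, f₁, Q)` solves the symmetric
system associated with the extended affine Weyl group of type `A₁⁽¹⁾`. -/
theorem PII_symmetric_form {K : Type*} [Field K] [CharZero K]
    (d : K → K)
    (hd_add : ∀ x y : K, d (x + y) = d x + d y)
    (hd_mul : ∀ x y : K, d (x * y) = x * d y + d x * y)
    (z : K) (hz : d z = 1)
    (α : K) (hα : d α = 0)
    (w : K) :
    let Q := 4 * w
    let f₀ := (1 / 2 : K) * (d w - w ^ 2 - z / 2)
    let f₁ := -(1 / 2 : K) * (d w + w ^ 2 + z / 2)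
    let β₀ := 2 * α - 1
    let β₁ := -(2 * α) - 1
    (d (d w) = 2 * w ^ 3 + z * w + α ↔
      (d f₀ = -(1 / 2 : K) * Q * f₀ + (1 / 4 : K) * β₀ ∧
       d f₁ = (1 / 2 : K) * Q * f₁ + (1 / 4 : K) * β₁ ∧
       d Q = 4 * (f₀ - f₁))) := by
  intro Q f₀ f₁ β₀ β₁
  let D : K →+ K := AddMonoidHom.mk' d hd_add
  have hD (x : K) : D x = d x := rfl
  have hQ : d Q = 4 * d w := by
    simpa [hD, Q] using map_nsmul D 4 w
  have half (x : K) : 2 * d (x / 2) = d x := by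
    rw [two_mul, ← hd_add, add_halves]
  have hz2 : d (z / 2) = 1 / 2 := by
    have h := half z
    rw [hz] at h
    linear_combination h / 2
  have hsq : d (w ^ 2) = 2 * w * d w := by
    rw [pow_two, hd_mul]
    ring
  have hf₀ : 2 * d f₀ = d (d w) - 2 * w * d w - 1 / 2 := by
    have e : f₀ = (d w - w ^ 2 - z / 2) / 2 := by simp only [f₀]; ring
    rw [e, half, ← hD, map_sub, map_sub, hD, hD, hD, hsq, hz2]
  have hf₁ : 2 * d f₁ = -(d (d w) + 2 * w * d w + 1 / 2) := by
    have e : f₁ = -(d w + w ^ 2 + z / 2) / 2 := by simp only [f₁]; ring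
    rw [e, half, ← hD, map_neg, hD, hd_add, hd_add, hsq, hz2]
  simp only [Q, f₀, f₁, β₀, β₁] at hQ hf₀ hf₁ ⊢
  constructor
  · intro h
    refine ⟨?_, ?_, ?_⟩
    · linear_combination hf₀ / 2 + h / 2
    · linear_combination hf₁ / 2 - h / 2
    · linear_combination hQ
  · rintro ⟨h, -, -⟩
    linear_combination 2 * h - hf₀
end
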